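/- For every E > 0 there is a constant C(E) > 0 with the following property. Let u be a smooth global solution of the defocusing quintic nonlinear wave equation with E(u(t)) ≤ E for all t ∈ ℝ, satisfying the a priori bounds with constant A. Then for every t₀ ∈ ℝ and every T > 0, ‖u‖_{L⁸_{t,x}([t₀,t₀+T]×ℝ³)}⁸ ≤ C(E) A⁸ (1+T). -/

import Mathlib

open MeasureTheory Real Set Function
open scoped ENNReal NNReal FourierTransform

noncomputable section

/-- Three-dimensional Euclidean space `ℝ³`. -/
abbrev E3 : Type := EuclideanSpace ℝ (Fin 3)

/-- The time derivative `∂ₜ u` of a function `u : ℝ × ℝ³ → ℝ` (curried). -/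
def tderiv (u : ℝ → E3 → ℝ) (t : ℝ) (x : E3) : ℝ := deriv (fun s => u s x) t

/-- The second time derivative `∂ₜ² u`. -/
def tderiv2 (u : ℝ → E3 → ℝ) (t : ℝ) (x : E3) : ℝ := deriv (fun s => tderiv u s x) t

/-- The spatial Laplacian `Δ f = ∑ᵢ ∂ᵢ² f` of `f : ℝ³ → ℝ`. -/
def lap (f : E3 → ℝ) (x : E3) : ℝ :=
  ∑ i : Fin 3, iteratedFDeriv ℝ 2 f x ![EuclideanSpace.single i 1, EuclideanSpace.single i 1]

/-- `f : ℝ³ → ℝ` is a Schwartz function: it is smooth and all of its derivatives decay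
faster than any polynomial. -/
def IsSchwartz (f : E3 → ℝ) : Prop :=
  ContDiff ℝ (⊤ : ℕ∞) f ∧ ∀ k n : ℕ, ∃ C : ℝ, ∀ x, ‖x‖ ^ k * ‖iteratedFDeriv ℝ n f x‖ ≤ C

/-- `u` is a smooth solution of the defocusing quintic nonlinear wave equation
`∂ₜ²u − Δu + u⁵ = 0` on the time interval `I`, Schwartz in the space variable at each time. -/
def IsNLWOn (u : ℝ → E3 → ℝ) (I : Set ℝ) : Prop :=
  ContDiffOn ℝ (⊤ : ℕ∞) (uncurry u) (I ×ˢ univ) ∧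
  (∀ t ∈ I, IsSchwartz (u t) ∧ IsSchwartz (tderiv u t)) ∧
  (∀ t ∈ I, ∀ x, tderiv2 u t x - lap (u t) x + (u t x) ^ 5 = 0)

/-- `u` is a smooth global solution of the defocusing quintic nonlinear wave equation. -/
def IsNLW (u : ℝ → E3 → ℝ) : Prop := IsNLWOn u univ

/-- The energy `E(u(t)) = ∫ (1/2)|∂ₜu|² + (1/2)|∇ₓu|² + (1/6)u⁶ dx`. -/
def energy (u : ℝ → E3 → ℝ) (t : ℝ) : ℝ :=
  ∫ x : E3, ((1/2) * (tderiv u t x) ^ 2 + (1/2) * ‖gradient (u t) x‖ ^ 2 + (1/6) * (u t x) ^ 6)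

/-- The spatial `L^q` norm (`q` finite), valued in `ℝ≥0∞`. -/
def xNorm {F : Type*} [NormedAddCommGroup F] (q : ℝ) (f : E3 → F) : ℝ≥0∞ :=
  (∫⁻ x : E3, (‖f x‖₊ : ℝ≥0∞) ^ q) ^ (1/q)

/-- The mixed norm `‖u‖_{L^p_t L^q_x (I × ℝ³)}` for finite `p, q`. -/
def mixNorm (p q : ℝ) (I : Set ℝ) (u : ℝ → E3 → ℝ) : ℝ≥0∞ :=
  (∫⁻ t in I, (xNorm q (u t)) ^ p) ^ (1/p)

/-- The mixed norm `‖u‖_{L^∞_t L^q_x (I × ℝ³)}` (essential supremum in time). -/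
def supNorm (q : ℝ) (I : Set ℝ) (u : ℝ → E3 → ℝ) : ℝ≥0∞ :=
  essSup (fun t => xNorm q (u t)) (volume.restrict I)

/-- The homogeneous Sobolev norm `‖f‖_{Ḣ^s} = (∫ |ξ|^{2s} |𝓕f(ξ)|² dξ)^{1/2}`. -/
def sobNorm (s : ℝ) (f : E3 → ℝ) : ℝ≥0∞ :=
  (∫⁻ ξ : E3, (‖ξ‖₊ : ℝ≥0∞) ^ (2*s) *
    (‖𝓕 (fun x => (f x : ℂ)) ξ‖₊ : ℝ≥0∞) ^ (2:ℝ)) ^ ((1:ℝ)/2)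

/-- The a priori bounds with constant `A`:
`‖u(t)‖_{L²} ≤ A`, `‖∂ₜu(t)‖_{Ḣ⁻¹} ≤ A`, `‖u(t)‖_{Ḣ²} ≤ A`, `‖∂ₜu(t)‖_{Ḣ¹} ≤ A` for all `t`. -/
def APriori (u : ℝ → E3 → ℝ) (A : ℝ) : Prop :=
  ∀ t : ℝ, xNorm 2 (u t) ≤ ENNReal.ofReal A ∧ sobNorm (-1) (tderiv u t) ≤ ENNReal.ofReal A ∧
    sobNorm 2 (u t) ≤ ENNReal.ofReal A ∧ sobNorm 1 (tderiv u t) ≤ ENNReal.ofReal A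

/-- The integral of `f` over the sphere of radius `r` about `x`, with respect to
two-dimensional Hausdorff (surface) measure. -/
def sphInt (x : E3) (r : ℝ) (f : E3 → ℝ) : ℝ := ∫ y in Metric.sphere x r, f y ∂(μH[2])

/-- The free wave evolution `S(t)(g, h)` given by Kirchhoff's formula. -/
def freeWave (g h : E3 → ℝ) (t : ℝ) (x : E3) : ℝ :=
  if t = 0 then g x
  else deriv (fun s => (1/(4*π*s)) * sphInt x s g) t + (1/(4*π*t)) * sphInt x t h

/-- The Duhamel integral `D_{[s₁,s₂]}u(t,x) = ∫_{s₁}^{s₂} S(t−τ)(0, u(τ)⁵) dτ`,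
written via Kirchhoff's formula. -/
def duh (u : ℝ → E3 → ℝ) (s₁ s₂ : ℝ) (t : ℝ) (x : E3) : ℝ :=
  ∫ τ in s₁..s₂, (1/(4*π*(t - τ))) * sphInt x (t - τ) (fun y => (u τ y) ^ 5)


open scoped SchwartzMap

/-- A real-valued Schwartz function, bundled as a complex-valued `SchwartzMap`. -/
def IsSchwartz.toSchwartzMap {f : E3 → ℝ} (hf : IsSchwartz f) : 𝓢(E3, ℂ) where
  toFun x := (f x : ℂ)
  smooth' := Complex.ofRealCLM.contDiff.comp hf.1
  decay' k n := by
    obtain ⟨C, hC⟩ := hf.2 k n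
    refine ⟨C, fun x => ?_⟩
    have h := Complex.ofRealLI.norm_iteratedFDeriv_comp_left (hf.1.contDiffAt (x := x))
      (i := n) (by exact_mod_cast le_top)
    have hfun : (fun x => (f x : ℂ)) = Complex.ofRealLI ∘ f := rfl
    rw [hfun, h]
    exact hC x

theorem SchwartzMap.lintegral_enorm_fourier_sq (F : 𝓢(E3, ℂ)) :
    ∫⁻ ξ, ‖𝓕 F ξ‖ₑ ^ (2 : ℝ) = ∫⁻ x, ‖F x‖ₑ ^ (2 : ℝ) := by
  have key (G : 𝓢(E3, ℂ)) : ∫⁻ x, ‖G x‖ₑ ^ (2 : ℝ) = ENNReal.ofReal (∫ x, ‖G x‖ ^ 2) := by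
    rw [ofReal_integral_eq_lintegral_ofReal]
    · refine lintegral_congr fun x => ?_
      rw [ENNReal.ofReal_pow (norm_nonneg _), ofReal_norm]
      exact ENNReal.rpow_natCast _ 2
    · simpa using (G.memLp 2).integrable_norm_pow (by norm_num)
    · exact .of_forall fun x => by positivity
  rw [key, key, F.integral_norm_sq_fourier]

theorem SchwartzMap.enorm_le_lintegral_enorm_fourier (F : 𝓢(E3, ℂ)) (x : E3) :
    ‖F x‖ₑ ≤ ∫⁻ ξ, ‖𝓕 F ξ‖ₑ := by
  have h : F x = 𝓕⁻ ((𝓕 F : 𝓢(E3, ℂ)) : E3 → ℂ) x := by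
    rw [← SchwartzMap.fourierInv_coe, FourierTransform.fourierInv_fourier_eq]
  rw [h, Real.fourierInv_eq]
  refine (enorm_integral_le_lintegral_enorm _).trans_eq (lintegral_congr fun ξ => ?_)
  rw [← ofReal_norm, ← ofReal_norm, Circle.norm_smul]

/-- The constant `∫ (1 + |ξ|)⁻⁴ dξ` on `ℝ³`. -/
def bracketConst : ℝ≥0∞ := ∫⁻ ξ : E3, ENNReal.ofReal ((1 + ‖ξ‖) ^ (-4 : ℝ))

theorem bracketConst_lt_top : bracketConst < ∞ :=
  finite_integral_one_add_norm (by simp; norm_num)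

/-- Cauchy–Schwarz against the weight `(1 + |ξ|)²`. -/
theorem lintegral_enorm_le_weighted {g : E3 → ℂ} (hg : Continuous g) :
    (∫⁻ ξ, ‖g ξ‖ₑ) ^ (2 : ℝ) ≤ bracketConst *
      (8 * ((∫⁻ ξ, ‖g ξ‖ₑ ^ (2 : ℝ)) + ∫⁻ ξ, ‖ξ‖ₑ ^ (4 : ℝ) * ‖g ξ‖ₑ ^ (2 : ℝ))) := by
  set v : E3 → ℝ≥0∞ := fun ξ => (1 + ‖ξ‖ₑ) ^ (-2 : ℝ) with hv
  set w : E3 → ℝ≥0∞ := fun ξ => (1 + ‖ξ‖ₑ) ^ (2 : ℝ) * ‖g ξ‖ₑ with hw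
  have hne (ξ : E3) : (1 + ‖ξ‖ₑ) ≠ 0 := by simp
  have htop (ξ : E3) : (1 + ‖ξ‖ₑ) ≠ ∞ := by simp
  have hvm : Measurable v := by fun_prop
  have hgm : Measurable fun ξ => ‖g ξ‖ₑ := hg.measurable.enorm
  have hwm : Measurable w := by fun_prop
  have hprod : ∫⁻ ξ, ‖g ξ‖ₑ = ∫⁻ ξ, (v * w) ξ := by
    refine lintegral_congr fun ξ => ?_
    simp only [hv, hw, Pi.mul_apply]
    rw [← mul_assoc, ← ENNReal.rpow_add _ _ (hne ξ) (htop ξ)]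
    simp
  have hvint : ∫⁻ ξ, v ξ ^ (2 : ℝ) = bracketConst := by
    refine lintegral_congr fun ξ => ?_
    have h1 : ENNReal.ofReal (1 + ‖ξ‖) = 1 + ‖ξ‖ₑ := by
      rw [ENNReal.ofReal_add zero_le_one (norm_nonneg _), ofReal_norm, ENNReal.ofReal_one]
    rw [← ENNReal.ofReal_rpow_of_pos (by positivity), h1, ← ENNReal.rpow_mul]
    norm_num
  have hwint : ∫⁻ ξ, w ξ ^ (2 : ℝ) ≤
      8 * ((∫⁻ ξ, ‖g ξ‖ₑ ^ (2 : ℝ)) + ∫⁻ ξ, ‖ξ‖ₑ ^ (4 : ℝ) * ‖g ξ‖ₑ ^ (2 : ℝ)) := by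
    rw [← lintegral_add_left (by fun_prop), ← lintegral_const_mul _ (by fun_prop)]
    refine lintegral_mono fun ξ => ?_
    simp only [hw]
    rw [ENNReal.mul_rpow_of_nonneg _ _ zero_le_two, ← ENNReal.rpow_mul]
    have h := ENNReal.rpow_add_le_mul_rpow_add_rpow 1 ‖ξ‖ₑ (p := 4) (by norm_num)
    have h8 : (2 : ℝ≥0∞) ^ ((4 : ℝ) - 1) = 8 := by
      rw [show (4 : ℝ) - 1 = (3 : ℕ) by norm_num, ENNReal.rpow_natCast]
      norm_num
    rw [h8, ENNReal.one_rpow] at h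
    calc (1 + ‖ξ‖ₑ) ^ ((2 : ℝ) * 2) * ‖g ξ‖ₑ ^ (2 : ℝ)
        = (1 + ‖ξ‖ₑ) ^ (4 : ℝ) * ‖g ξ‖ₑ ^ (2 : ℝ) := by norm_num
      _ ≤ 8 * (1 + ‖ξ‖ₑ ^ (4 : ℝ)) * ‖g ξ‖ₑ ^ (2 : ℝ) := by gcongr
      _ = _ := by ring
  have hholder := ENNReal.lintegral_mul_le_Lp_mul_Lq volume Real.HolderConjugate.two_two
    hvm.aemeasurable hwm.aemeasurable
  rw [← hprod, hvint, ← ENNReal.mul_rpow_of_nonneg _ _ (by norm_num)] at hholder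
  calc (∫⁻ ξ, ‖g ξ‖ₑ) ^ (2 : ℝ)
      ≤ ((bracketConst * ∫⁻ ξ, w ξ ^ (2 : ℝ)) ^ ((1 : ℝ) / 2)) ^ (2 : ℝ) := by gcongr
    _ = bracketConst * ∫⁻ ξ, w ξ ^ (2 : ℝ) := by rw [← ENNReal.rpow_mul]; norm_num
    _ ≤ _ := by gcongr

theorem lintegral_le_of_xNorm_two_le {f : E3 → ℝ} {a : ℝ≥0∞} (h : xNorm 2 f ≤ a) :
    ∫⁻ x, ‖f x‖ₑ ^ (2 : ℝ) ≤ a ^ (2 : ℝ) := by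
  have hpow := ENNReal.rpow_le_rpow h (zero_le_two (α := ℝ))
  rw [xNorm, ← ENNReal.rpow_mul, show (1 : ℝ) / 2 * 2 = 1 by norm_num,
    ENNReal.rpow_one] at hpow
  exact hpow

theorem lintegral_le_of_sobNorm_two_le {f : E3 → ℝ} {a : ℝ≥0∞} (h : sobNorm 2 f ≤ a) :
    ∫⁻ ξ, ‖ξ‖ₑ ^ (4 : ℝ) * ‖𝓕 (fun x => (f x : ℂ)) ξ‖ₑ ^ (2 : ℝ) ≤ a ^ (2 : ℝ) := by
  have hpow := ENNReal.rpow_le_rpow h (zero_le_two (α := ℝ))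
  rw [sobNorm, ← ENNReal.rpow_mul, show (2 : ℝ) * 2 = 4 by norm_num,
    show (1 : ℝ) / 2 * 2 = 1 by norm_num, ENNReal.rpow_one] at hpow
  exact hpow

/-- The Sobolev embedding `L² ∩ Ḣ² ⊂ L^∞` on `ℝ³`. -/
theorem IsSchwartz.enorm_sq_le {f : E3 → ℝ} (hf : IsSchwartz f) {a : ℝ≥0∞}
    (h0 : xNorm 2 f ≤ a) (h2 : sobNorm 2 f ≤ a) (x : E3) :
    ‖f x‖ₑ ^ (2 : ℝ) ≤ 16 * bracketConst * a ^ (2 : ℝ) := by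
  set F := hf.toSchwartzMap
  have hFx (y : E3) : ‖F y‖ₑ = ‖f y‖ₑ := by
    rw [← ofReal_norm, ← ofReal_norm]
    exact congrArg _ (Complex.norm_real _)
  calc ‖f x‖ₑ ^ (2 : ℝ)
      ≤ (∫⁻ ξ, ‖𝓕 F ξ‖ₑ) ^ (2 : ℝ) := by
        rw [← hFx]
        gcongr
        exact F.enorm_le_lintegral_enorm_fourier x
    _ ≤ bracketConst *
        (8 * ((∫⁻ ξ, ‖𝓕 F ξ‖ₑ ^ (2 : ℝ)) + ∫⁻ ξ, ‖ξ‖ₑ ^ (4 : ℝ) * ‖𝓕 F ξ‖ₑ ^ (2 : ℝ))) :=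
        lintegral_enorm_le_weighted (𝓕 F).continuous
    _ ≤ bracketConst * (8 * (a ^ (2 : ℝ) + a ^ (2 : ℝ))) := by
        gcongr
        · rw [F.lintegral_enorm_fourier_sq]
          simp only [hFx]
          exact lintegral_le_of_xNorm_two_le h0
        · exact lintegral_le_of_sobNorm_two_le h2
    _ = 16 * bracketConst * a ^ (2 : ℝ) := by ring

theorem IsSchwartz.xNorm_eight_le {f : E3 → ℝ} (hf : IsSchwartz f) {a : ℝ≥0∞}
    (h0 : xNorm 2 f ≤ a) (h2 : sobNorm 2 f ≤ a) :
    xNorm 8 f ^ (8 : ℝ) ≤ (16 * bracketConst) ^ 3 * a ^ 8 := by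
  have hsplit (x : E3) : ‖f x‖ₑ ^ (8 : ℝ) = (‖f x‖ₑ ^ (2 : ℝ)) ^ 3 * ‖f x‖ₑ ^ (2 : ℝ) := by
    rw [← pow_succ, ← ENNReal.rpow_natCast, ← ENNReal.rpow_mul]
    norm_num
  have hm : Measurable fun x => ‖f x‖ₑ := hf.1.continuous.measurable.enorm
  calc xNorm 8 f ^ (8 : ℝ) = ∫⁻ x, ‖f x‖ₑ ^ (8 : ℝ) := by
        rw [xNorm, ← ENNReal.rpow_mul, show (1 : ℝ) / 8 * 8 = 1 by norm_num, ENNReal.rpow_one]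
        rfl
    _ ≤ ∫⁻ x, (16 * bracketConst * a ^ (2 : ℝ)) ^ 3 * ‖f x‖ₑ ^ (2 : ℝ) := by
        refine lintegral_mono fun x => ?_
        simp only [hsplit]
        gcongr
        exact hf.enorm_sq_le h0 h2 x
    _ = (16 * bracketConst * a ^ (2 : ℝ)) ^ 3 * ∫⁻ x, ‖f x‖ₑ ^ (2 : ℝ) :=
        lintegral_const_mul _ (by fun_prop)
    _ ≤ (16 * bracketConst * a ^ (2 : ℝ)) ^ 3 * a ^ (2 : ℝ) := by
        gcongr
        exact lintegral_le_of_xNorm_two_le h0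
    _ = (16 * bracketConst) ^ 3 * a ^ 8 := by
        rw [show a ^ (2 : ℝ) = a ^ 2 from ENNReal.rpow_natCast a 2]
        ring

/-- `‖u‖_{L⁸_{t,x}([t₀,t₀+T]×ℝ³)}⁸ ≲_E A⁸ (1+T)`. -/
theorem stmt3 (E : ℝ) (hE : 0 < E) :
    ∃ C : ℝ, 0 < C ∧ ∀ (A : ℝ) (u : ℝ → E3 → ℝ),
      IsNLW u → (∀ t : ℝ, energy u t ≤ E) → APriori u A →
      ∀ (t₀ T : ℝ), 0 < T →
        (mixNorm 8 8 (Icc t₀ (t₀ + T)) u) ^ (8:ℝ) ≤ ENNReal.ofReal (C * A ^ 8 * (1 + T)) := by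
  have hK : (16 * bracketConst) ^ 3 ≠ ∞ :=
    ENNReal.pow_ne_top (ENNReal.mul_ne_top (by norm_num) bracketConst_lt_top.ne)
  refine ⟨((16 * bracketConst) ^ 3).toReal + 1, by positivity, ?_⟩
  intro A u hu _ hA t₀ T hT
  set K := ((16 * bracketConst) ^ 3).toReal
  have hK0 : 0 ≤ K := ENNReal.toReal_nonneg
  have hA8 : ENNReal.ofReal A ^ 8 ≤ ENNReal.ofReal (A ^ 8) := by
    rcases le_total 0 A with h | h
    · rw [ENNReal.ofReal_pow h]
    · simp [ENNReal.ofReal_of_nonpos h]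
  have hA0 : 0 ≤ A ^ 8 := Even.pow_nonneg (by decide) A
  calc (mixNorm 8 8 (Icc t₀ (t₀ + T)) u) ^ (8 : ℝ)
      = ∫⁻ t in Icc t₀ (t₀ + T), xNorm 8 (u t) ^ (8 : ℝ) := by
        rw [mixNorm, ← ENNReal.rpow_mul, show (1 : ℝ) / 8 * 8 = 1 by norm_num, ENNReal.rpow_one]
    _ ≤ ∫⁻ _ in Icc t₀ (t₀ + T), (16 * bracketConst) ^ 3 * ENNReal.ofReal A ^ 8 :=
        lintegral_mono fun t => (hu.2.1 t (mem_univ t)).1.xNorm_eight_le (hA t).1 (hA t).2.2.1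
    _ = ENNReal.ofReal K * ENNReal.ofReal A ^ 8 * ENNReal.ofReal T := by
        rw [setLIntegral_const, Real.volume_Icc, ENNReal.ofReal_toReal hK, add_sub_cancel_left]
    _ ≤ ENNReal.ofReal K * ENNReal.ofReal (A ^ 8) * ENNReal.ofReal T := by gcongr
    _ = ENNReal.ofReal (K * A ^ 8 * T) := by
        rw [ENNReal.ofReal_mul (by positivity), ENNReal.ofReal_mul hK0]
    _ ≤ ENNReal.ofReal ((K + 1) * A ^ 8 * (1 + T)) := by
        gcongr <;> linarith

end
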